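/- Under the Carleman hypothesis, let X^δ ⊆ X and Y^δ ⊆ Y be subspaces, let Q : Y → Y be a bounded linear map with range contained in Y^δ and with (Bw)(μ − Qμ) = 0 for all w ∈ X^δ and μ ∈ Y, and set e_osc(g) := ‖g ∘ (Id − Q)‖_{Y'}. If ε ≥ 0 and u_ε ∈ X satisfies G_ε(u_ε) ≤ G_ε(v) for all v ∈ X, then for every w ∈ X^δ one has the computable a posteriori bound N(u_ε − w) ≤ 2C_η·(max(1, ‖Q‖)·√(G_ε^δ(w)) + e_osc(g)). -/

import Mathlib

/-- The discrete dual norm `‖ℓ‖_{(Y^δ)'} = sup { ℓ μ : μ ∈ Y^δ, ‖μ‖ ≤ 1 }`. -/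
noncomputable def discreteDualNorm {Y : Type*} [NormedAddCommGroup Y]
    [InnerProductSpace ℝ Y] (Yδ : Submodule ℝ Y) (ℓ : Y →L[ℝ] ℝ) : ℝ :=
  sSup ((fun μ => ℓ μ) '' {μ : Y | μ ∈ Yδ ∧ ‖μ‖ ≤ 1})

section DiscreteDualNorm

variable {Y : Type*} [NormedAddCommGroup Y] [InnerProductSpace ℝ Y]

theorem apply_le_discreteDualNorm (Yδ : Submodule ℝ Y) (ℓ : Y →L[ℝ] ℝ) {μ : Y}
    (hμ : μ ∈ Yδ) (hμ1 : ‖μ‖ ≤ 1) : ℓ μ ≤ discreteDualNorm Yδ ℓ := by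
  refine le_csSup ⟨‖ℓ‖, ?_⟩ ⟨μ, ⟨hμ, hμ1⟩, rfl⟩
  rintro _ ⟨ν, ⟨-, hν⟩, rfl⟩
  exact (le_abs_self _).trans (ℓ.unit_le_opNorm ν hν)

theorem discreteDualNorm_nonneg (Yδ : Submodule ℝ Y) (ℓ : Y →L[ℝ] ℝ) :
    0 ≤ discreteDualNorm Yδ ℓ := by
  simpa using apply_le_discreteDualNorm Yδ ℓ Yδ.zero_mem (by simp)

theorem apply_le_discreteDualNorm_mul_norm (Yδ : Submodule ℝ Y) (ℓ : Y →L[ℝ] ℝ) {μ : Y}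
    (hμ : μ ∈ Yδ) : ℓ μ ≤ discreteDualNorm Yδ ℓ * ‖μ‖ := by
  rcases eq_or_ne μ 0 with rfl | h0
  · simp
  have hpos : 0 < ‖μ‖ := norm_pos_iff.mpr h0
  have h := apply_le_discreteDualNorm Yδ ℓ (Yδ.smul_mem ‖μ‖⁻¹ hμ)
    (by rw [norm_smul, norm_inv, norm_norm, inv_mul_cancel₀ hpos.ne'])
  rw [map_smul, smul_eq_mul, inv_mul_le_iff₀ hpos] at h
  linarith

theorem abs_apply_le_discreteDualNorm_mul_norm (Yδ : Submodule ℝ Y) (ℓ : Y →L[ℝ] ℝ) {μ : Y}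
    (hμ : μ ∈ Yδ) : |ℓ μ| ≤ discreteDualNorm Yδ ℓ * ‖μ‖ :=
  abs_le'.mpr ⟨apply_le_discreteDualNorm_mul_norm Yδ ℓ hμ, by
    simpa using apply_le_discreteDualNorm_mul_norm Yδ ℓ (Yδ.neg_mem hμ)⟩

/-- A Fortin operator `Q` controls the dual norm of a residual `b - g` by its discrete dual norm
and the data oscillation. -/
theorem norm_sub_le_of_fortin (Yδ : Submodule ℝ Y) (b g : Y →L[ℝ] ℝ) (Q : Y →L[ℝ] Y)
    (hran : ∀ μ, Q μ ∈ Yδ) (hb : ∀ μ, b (μ - Q μ) = 0) :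
    ‖b - g‖ ≤ ‖Q‖ * discreteDualNorm Yδ (b - g) +
      ‖g.comp (ContinuousLinearMap.id ℝ Y - Q)‖ := by
  have hd := discreteDualNorm_nonneg Yδ (b - g)
  refine ContinuousLinearMap.opNorm_le_bound _ (by positivity) fun μ => ?_
  have hsplit : (b - g) μ = (b - g) (Q μ) - g.comp (ContinuousLinearMap.id ℝ Y - Q) μ := by
    have := hb μ
    simp only [map_sub] at this
    simp only [sub_apply, ContinuousLinearMap.comp_apply,
      ContinuousLinearMap.id_apply, map_sub]
    linarith
  calc ‖(b - g) μ‖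
      ≤ ‖(b - g) (Q μ)‖ + ‖g.comp (ContinuousLinearMap.id ℝ Y - Q) μ‖ := by
        rw [hsplit]
        exact norm_sub_le _ _
    _ ≤ discreteDualNorm Yδ (b - g) * (‖Q‖ * ‖μ‖) +
          ‖g.comp (ContinuousLinearMap.id ℝ Y - Q)‖ * ‖μ‖ := by
        gcongr
        · exact (abs_apply_le_discreteDualNorm_mul_norm Yδ (b - g) (hran μ)).trans
            (mul_le_mul_of_nonneg_left (Q.le_opNorm μ) hd)
        · exact ContinuousLinearMap.le_opNorm _ μ
    _ = _ := by ring

end DiscreteDualNorm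

theorem norm_sub_sq_le_two_mul {E : Type*} [SeminormedAddCommGroup E] (x y z : E) :
    ‖x - y‖ ^ 2 ≤ 2 * (‖x - z‖ ^ 2 + ‖y - z‖ ^ 2) := by
  have h : ‖x - y‖ ≤ ‖x - z‖ + ‖y - z‖ := by
    simpa using norm_sub_le (x - z) (y - z)
  exact (pow_le_pow_left₀ (norm_nonneg _) h 2).trans add_sq_le

theorem add_sq_add_le_sq_mul_sqrt_add {M d o s : ℝ} (hM : 1 ≤ M) (ho : 0 ≤ o) (hs : 0 ≤ s) :
    (M * d + o) ^ 2 + s ≤ (M * Real.sqrt (d ^ 2 + s) + o) ^ 2 := by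
  have hsq : Real.sqrt (d ^ 2 + s) ^ 2 = d ^ 2 + s := Real.sq_sqrt (by positivity)
  have hd : d ≤ Real.sqrt (d ^ 2 + s) := Real.le_sqrt_of_sq_le (by linarith)
  have hcross : M * o * d ≤ M * o * Real.sqrt (d ^ 2 + s) :=
    mul_le_mul_of_nonneg_left hd (by positivity)
  have hMs : s ≤ M ^ 2 * s := le_mul_of_one_le_left hs (one_le_pow₀ hM)
  calc (M * d + o) ^ 2 + s = M ^ 2 * d ^ 2 + 2 * (M * o * d) + o ^ 2 + s := by ring
    _ ≤ M ^ 2 * (d ^ 2 + s) + 2 * (M * o * Real.sqrt (d ^ 2 + s)) + o ^ 2 := by linarith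
    _ = _ := by
      rw [add_sq, mul_pow, hsq]
      ring

/-- Corollary 3.10: computable a posteriori error bound. -/
theorem stmt_12
    {X Y Hω H₀ : Type*}
    [NormedAddCommGroup X] [InnerProductSpace ℝ X] [CompleteSpace X]
    [NormedAddCommGroup Y] [InnerProductSpace ℝ Y] [CompleteSpace Y]
    [NormedAddCommGroup Hω] [InnerProductSpace ℝ Hω] [CompleteSpace Hω]
    [NormedAddCommGroup H₀] [InnerProductSpace ℝ H₀] [CompleteSpace H₀]
    (B : X →L[ℝ] (Y →L[ℝ] ℝ)) (Γ : X →L[ℝ] Hω) (γ₀ : X →L[ℝ] H₀)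
    (g : Y →L[ℝ] ℝ) (f : Hω)
    (N : Seminorm ℝ X) (Cη : ℝ) (hCη : 0 < Cη)
    (hCarl : ∀ w : X, N w ≤ Cη * Real.sqrt (‖B w‖ ^ 2 + ‖Γ w‖ ^ 2))
    (Xδ : Submodule ℝ X) (Yδ : Submodule ℝ Y)
    (Q : Y →L[ℝ] Y)
    (hran : ∀ μ : Y, Q μ ∈ Yδ)
    (hFortin : ∀ w ∈ Xδ, ∀ μ : Y, B w (μ - Q μ) = 0)
    (ε : ℝ) (hε : 0 ≤ ε) (uε : X)
    (hmin : ∀ v : X,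
      ‖B uε - g‖ ^ 2 + ‖Γ uε - f‖ ^ 2 + ε ^ 2 * ‖γ₀ uε‖ ^ 2 ≤
        ‖B v - g‖ ^ 2 + ‖Γ v - f‖ ^ 2 + ε ^ 2 * ‖γ₀ v‖ ^ 2) :
    ∀ w ∈ Xδ,
      N (uε - w) ≤ 2 * Cη *
        (max 1 ‖Q‖ *
          Real.sqrt (discreteDualNorm Yδ (B w - g) ^ 2 + ‖Γ w - f‖ ^ 2 +
            ε ^ 2 * ‖γ₀ w‖ ^ 2) +
         ‖g.comp (ContinuousLinearMap.id ℝ Y - Q)‖) := by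
  intro w hw
  set d := discreteDualNorm Yδ (B w - g)
  set o := ‖g.comp (ContinuousLinearMap.id ℝ Y - Q)‖
  have hd : 0 ≤ d := discreteDualNorm_nonneg _ _
  have ho : 0 ≤ o := norm_nonneg _
  have hres : ‖B w - g‖ ≤ max 1 ‖Q‖ * d + o :=
    (norm_sub_le_of_fortin Yδ (B w) g Q hran (hFortin w hw)).trans
      (by gcongr; exact le_max_right _ _)
  have hG : ‖B w - g‖ ^ 2 + (‖Γ w - f‖ ^ 2 + ε ^ 2 * ‖γ₀ w‖ ^ 2) ≤
      (max 1 ‖Q‖ * Real.sqrt (d ^ 2 + (‖Γ w - f‖ ^ 2 + ε ^ 2 * ‖γ₀ w‖ ^ 2)) + o) ^ 2 :=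
    (by gcongr : _ ≤ (max 1 ‖Q‖ * d + o) ^ 2 + (‖Γ w - f‖ ^ 2 + ε ^ 2 * ‖γ₀ w‖ ^ 2)).trans
      (add_sq_add_le_sq_mul_sqrt_add (le_max_left _ _) ho (by positivity))
  have hB := norm_sub_sq_le_two_mul (B uε) (B w) g
  have hΓ := norm_sub_sq_le_two_mul (Γ uε) (Γ w) f
  have hu : 0 ≤ ε ^ 2 * ‖γ₀ uε‖ ^ 2 := by positivity
  have hw0 : 0 ≤ ε ^ 2 * ‖γ₀ w‖ ^ 2 := by positivity
  rw [add_assoc (d ^ 2)]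
  refine (hCarl (uε - w)).trans ?_
  rw [mul_comm 2 Cη, mul_assoc]
  refine mul_le_mul_of_nonneg_left (Real.sqrt_le_iff.mpr ⟨by positivity, ?_⟩) hCη.le
  rw [map_sub, map_sub, mul_pow]
  linarith [hmin w]
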